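/- arXiv:2003.12965 — 2 statements merged into one kernel-verified Lean document; each statement's English description precedes it below -/
import Mathlib

section
/- Let g be the multiplicative function on squarefree integers defined by g(p) = 0 for primes p ≤ e² and g(p) = ⌊p / log p⌋ for primes p > e² (and g(q) = 0 if q is not squarefree). Then there exists an absolute constant C such that for all sufficiently large x, ∑_{q ≤ x} g(q) ≤ C ∑_{p ≤ x} g(p). -/
/-- The multiplicative function `g` supported on squarefree integers with
`g(p) = 0` for primes `p ≤ e²` and `g(p) = ⌊p / log p⌋` for primes `p > e²`. -/
noncomputable def weirdG (q : ℕ) : ℝ :=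
  if Squarefree q then
    ∏ p ∈ q.primeFactors,
      (if (p : ℝ) ≤ Real.exp 2 then 0 else (⌊(p : ℝ) / Real.log p⌋ : ℝ))
  else 0

open Finset Real
open ArithmeticFunction hiding log

/-- The arithmetic function supported on squarefree integers, multiplicative there, with value
`f p` at each prime `p`. -/
noncomputable def squarefreeProd (f : ℕ → ℝ) : ArithmeticFunction ℝ where
  toFun n := if Squarefree n then ∏ p ∈ n.primeFactors, f p else 0
  map_zero' := by simp

theorem squarefreeProd_apply (f : ℕ → ℝ) (n : ℕ) :
    squarefreeProd f n = if Squarefree n then ∏ p ∈ n.primeFactors, f p else 0 := rfl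

theorem squarefreeProd_nonneg {f : ℕ → ℝ} (hf : ∀ p, p.Prime → 0 ≤ f p) (n : ℕ) :
    0 ≤ squarefreeProd f n := by
  rw [squarefreeProd_apply]
  split_ifs
  · exact prod_nonneg fun p hp ↦ hf p (Nat.prime_of_mem_primeFactors hp)
  · rfl

theorem squarefreeProd_le_one {f : ℕ → ℝ} (hf : ∀ p, p.Prime → 0 ≤ f p)
    (hf1 : ∀ p, p.Prime → f p ≤ 1) (n : ℕ) : squarefreeProd f n ≤ 1 := by
  rw [squarefreeProd_apply]
  split_ifs
  · exact prod_le_one (fun p hp ↦ hf p (Nat.prime_of_mem_primeFactors hp))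
      fun p hp ↦ hf1 p (Nat.prime_of_mem_primeFactors hp)
  · exact zero_le_one

theorem squarefreeProd_prime (f : ℕ → ℝ) {p : ℕ} (hp : p.Prime) : squarefreeProd f p = f p := by
  simp [squarefreeProd_apply, hp.primeFactors,
    hp.prime.squarefree]

theorem squarefreeProd_mul (f : ℕ → ℝ) {m n : ℕ} (h : Squarefree (m * n)) :
    squarefreeProd f (m * n) = squarefreeProd f m * squarefreeProd f n := by
  have hmn := Nat.coprime_of_squarefree_mul h
  rw [squarefreeProd_apply, squarefreeProd_apply, squarefreeProd_apply, if_pos h,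
    if_pos h.of_mul_left, if_pos h.of_mul_right, hmn.primeFactors_mul,
    prod_union hmn.disjoint_primeFactors]

theorem log_eq_sum_primeFactors {n : ℕ} (hn : Squarefree n) :
    log n = ∑ p ∈ n.primeFactors, log p := by
  conv_lhs => rw [← Nat.prod_primeFactors_of_squarefree hn]
  rw [Nat.cast_prod, log_prod]
  intro p hp
  exact_mod_cast (Nat.prime_of_mem_primeFactors hp).ne_zero

/-- A product of two primes in increasing order determines its factors. -/
theorem sum_prime_pairs_lt_le_sum_divisors {n : ℕ} (hn : n ≠ 0) {B : ℕ → ℝ} (hB : ∀ d, 0 ≤ B d) :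
    ∑ p ∈ n.primeFactors, ∑ q ∈ n.primeFactors, (if p < q then B (p * q) else 0)
      ≤ ∑ d ∈ n.divisors, B d := by
  rw [← sum_product' n.primeFactors n.primeFactors (fun p q ↦ if p < q then B (p * q) else 0),
    ← sum_filter]
  have hinj : Set.InjOn (fun x : ℕ × ℕ ↦ x.1 * x.2)
      ((n.primeFactors ×ˢ n.primeFactors).filter fun x ↦ x.1 < x.2) := by
    rintro ⟨p, q⟩ hx ⟨r, s⟩ hy hxy
    simp only [coe_filter, mem_product, Nat.mem_primeFactors, Set.mem_ofPred_eq] at hx hy hxy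
    have hp := hx.1.1.1
    have hr := hy.1.1.1
    have hq := hx.1.2.1
    have hs := hy.1.2.1
    have hpr : p = r := by
      have h1 : p ∣ r * s := hxy ▸ dvd_mul_right p q
      have h2 : r ∣ p * q := hxy ▸ dvd_mul_right r s
      rw [hp.dvd_mul, Nat.prime_dvd_prime_iff_eq hp hr, Nat.prime_dvd_prime_iff_eq hp hs] at h1
      rw [hr.dvd_mul, Nat.prime_dvd_prime_iff_eq hr hp, Nat.prime_dvd_prime_iff_eq hr hq] at h2
      omega
    subst hpr
    simpa [hp.ne_zero] using hxy
  rw [← sum_image (f := B) (g := fun x : ℕ × ℕ ↦ x.1 * x.2) hinj]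
  refine sum_le_sum_of_subset_of_nonneg ?_ fun _ _ _ ↦ hB _
  intro d hd
  simp only [mem_image, mem_filter, mem_product, Nat.mem_primeFactors, Prod.exists] at hd
  obtain ⟨p, q, ⟨⟨⟨hp, hpn, -⟩, hq, hqn, -⟩, hlt⟩, rfl⟩ := hd
  exact Nat.mem_divisors.mpr
    ⟨((Nat.coprime_primes hp hq).mpr hlt.ne).mul_dvd_of_dvd_of_dvd hpn hqn, hn⟩

/-- The weight `log p` at primes `p`, increased by `2` everywhere. -/
noncomputable def primeLogAddTwo : ArithmeticFunction ℝ where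
  toFun n := if n = 0 then 0 else (if n.Prime then log n else 0) + 2
  map_zero' := by simp

theorem primeLogAddTwo_apply {n : ℕ} (hn : n ≠ 0) :
    primeLogAddTwo n = (if n.Prime then log n else 0) + 2 := if_neg hn

theorem sum_primeLogAddTwo_le (N : ℕ) :
    ∑ n ∈ Ioc 0 N, primeLogAddTwo n ≤ (log 4 + 2) * N := by
  have h : ∑ n ∈ Ioc 0 N, primeLogAddTwo n = Chebyshev.theta N + 2 * N := by
    rw [Chebyshev.theta, Nat.floor_natCast, sum_filter,
      sum_congr rfl fun n hn ↦ primeLogAddTwo_apply (mem_Ioc.mp hn).1.ne', sum_add_distrib]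
    simp [mul_comm]
  linarith [Chebyshev.theta_le_log4_mul_x N.cast_nonneg]


theorem squarefreeProd_mul_log_sq_le {f : ℕ → ℝ} (hf : ∀ p, p.Prime → 0 ≤ f p)
    (hlog : ∀ p, p.Prime → f p * log p ≤ 1) (n : ℕ) :
    squarefreeProd f n * log n ^ 2 ≤ (squarefreeProd f * primeLogAddTwo) n := by
  set H := squarefreeProd f with hH
  have H0 : ∀ m, 0 ≤ H m := squarefreeProd_nonneg hf
  have l0 : ∀ m : ℕ, 0 ≤ log m := fun m ↦ log_natCast_nonneg m
  by_cases hn : Squarefree n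
  swap
  · rw [hH, squarefreeProd_apply, if_neg hn, zero_mul, mul_apply]
    refine sum_nonneg fun x hx ↦ mul_nonneg (H0 _) ?_
    obtain ⟨hx, hn0⟩ := Nat.mem_divisorsAntidiagonal.mp hx
    rw [primeLogAddTwo_apply (by rintro h; simp_all)]
    split_ifs <;> linarith [l0 x.2]
  have hn0 := hn.ne_zero
  have hdiag : ∀ p ∈ n.primeFactors, H n * (log p * log p) ≤ log p * H (n / p) := by
    intro p hp
    have hpp := Nat.prime_of_mem_primeFactors hp
    obtain ⟨m, rfl⟩ := Nat.dvd_of_mem_primeFactors hp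
    rw [Nat.mul_div_cancel_left _ hpp.pos, hH, squarefreeProd_mul f hn,
      squarefreeProd_prime f hpp]
    nlinarith [mul_nonneg (mul_nonneg (l0 p) (H0 m)) (sub_nonneg.mpr (hlog p hpp))]
  have hoff : ∀ p ∈ n.primeFactors, ∀ q ∈ n.primeFactors, p ≠ q →
      H n * (log p * log q) ≤ H (n / (p * q)) := by
    intro p hp q hq hpq
    have hpp := Nat.prime_of_mem_primeFactors hp
    have hqq := Nat.prime_of_mem_primeFactors hq
    obtain ⟨m, rfl⟩ := ((Nat.coprime_primes hpp hqq).mpr hpq).mul_dvd_of_dvd_of_dvd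
      (Nat.dvd_of_mem_primeFactors hp) (Nat.dvd_of_mem_primeFactors hq)
    rw [Nat.mul_div_cancel_left _ (Nat.mul_pos hpp.pos hqq.pos), hH, squarefreeProd_mul f hn,
      squarefreeProd_mul f hn.of_mul_left, squarefreeProd_prime f hpp, squarefreeProd_prime f hqq]
    have h1 : (f p * log p) * (f q * log q) ≤ 1 :=
      mul_le_one₀ (hlog p hpp) (mul_nonneg (hf q hqq) (l0 q)) (hlog q hqq)
    have := mul_le_mul_of_nonneg_right h1 (H0 m)
    simp only [hH] at this
    linarith
  have hpt : ∀ p ∈ n.primeFactors, ∀ q ∈ n.primeFactors, H n * (log p * log q) ≤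
      (if p = q then log p * H (n / p) else 0) + (if p < q then H (n / (p * q)) else 0)
        + (if q < p then H (n / (q * p)) else 0) := by
    intro p hp q hq
    rcases lt_trichotomy p q with h | rfl | h
    · simpa [h, h.ne, h.not_gt] using hoff p hp q hq h.ne
    · simpa using hdiag p hp
    · simpa [h, h.ne', h.not_gt, mul_comm q p] using hoff p hp q hq h.ne'
  have hlt := sum_prime_pairs_lt_le_sum_divisors hn0 (B := fun d ↦ H (n / d)) fun d ↦ H0 _
  calc H n * log n ^ 2
      = ∑ p ∈ n.primeFactors, ∑ q ∈ n.primeFactors, H n * (log p * log q) := by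
        rw [log_eq_sum_primeFactors hn, sq, sum_mul_sum]
        simp_rw [mul_sum]
    _ ≤ ∑ p ∈ n.primeFactors, ∑ q ∈ n.primeFactors,
          ((if p = q then log p * H (n / p) else 0) + (if p < q then H (n / (p * q)) else 0)
            + (if q < p then H (n / (q * p)) else 0)) :=
        sum_le_sum fun p hp ↦ sum_le_sum fun q hq ↦ hpt p hp q hq
    _ ≤ (∑ p ∈ n.primeFactors, log p * H (n / p)) + (∑ d ∈ n.divisors, H (n / d))
          + ∑ d ∈ n.divisors, H (n / d) := by
        simp_rw [sum_add_distrib]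
        refine add_le_add (add_le_add (le_of_eq ?_) hlt) ?_
        · exact sum_congr rfl fun p hp ↦ by rw [sum_ite_eq, if_pos hp]
        · rw [sum_comm]
          exact hlt
    _ = (H * primeLogAddTwo) n := by
        have hsplit : ∀ d ∈ n.divisors, H (n / d) * primeLogAddTwo d
            = (if d.Prime then log d * H (n / d) else 0) + (H (n / d) + H (n / d)) := by
          intro d hd
          rw [primeLogAddTwo_apply (Nat.pos_of_mem_divisors hd).ne']
          split_ifs <;> ring
        rw [mul_apply, Nat.sum_divisorsAntidiagonal' (fun i j ↦ H i * primeLogAddTwo j),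
          sum_congr rfl hsplit, sum_add_distrib, sum_add_distrib, ← sum_filter,
          Nat.primeFactors_eq_to_filter_divisors_prime, add_assoc]

theorem sum_squarefreeProd_mul_log_sq_le {f : ℕ → ℝ} (hf : ∀ p, p.Prime → 0 ≤ f p)
    (hlog : ∀ p, p.Prime → f p * log p ≤ 1) (N : ℕ) :
    ∑ n ∈ Ioc 0 N, squarefreeProd f n * log n ^ 2
      ≤ (log 4 + 2) * N * ∑ n ∈ Ioc 0 N, squarefreeProd f n / n := by
  have l4 : 0 ≤ log 4 := log_nonneg (by norm_num)
  calc _ ≤ ∑ n ∈ Ioc 0 N, (squarefreeProd f * primeLogAddTwo) n :=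
        sum_le_sum fun n _ ↦ squarefreeProd_mul_log_sq_le hf hlog n
    _ = ∑ n ∈ Ioc 0 N, squarefreeProd f n * ∑ m ∈ Ioc 0 (N / n), primeLogAddTwo m :=
        sum_Ioc_mul_eq_sum_sum _ _ _
    _ ≤ ∑ n ∈ Ioc 0 N, squarefreeProd f n * ((log 4 + 2) * (N / n)) := by
        gcongr with n hn
        · exact squarefreeProd_nonneg hf n
        · refine (sum_primeLogAddTwo_le _).trans ?_
          gcongr
          exact Nat.cast_div_le
    _ = _ := by
        rw [mul_sum]
        exact sum_congr rfl fun n _ ↦ by ring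

theorem sum_squarefreeProd_div_le {f : ℕ → ℝ} (hf : ∀ p, p.Prime → 0 ≤ f p) (N : ℕ) :
    ∑ n ∈ Ioc 0 N, squarefreeProd f n / n
      ≤ exp (∑ p ∈ (Ioc 0 N).filter Nat.Prime, f p / p) := by
  have hinj : Set.InjOn Nat.primeFactors ((Ioc 0 N).filter Squarefree) := by
    intro a ha b hb hab
    simp only [coe_filter, Set.mem_ofPred_eq] at ha hb
    rw [← Nat.prod_primeFactors_of_squarefree ha.2, hab,
      Nat.prod_primeFactors_of_squarefree hb.2]
  calc _ = ∑ n ∈ (Ioc 0 N).filter Squarefree, ∏ p ∈ n.primeFactors, f p / p := by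
        rw [sum_filter]
        refine sum_congr rfl fun n _ ↦ ?_
        rw [squarefreeProd_apply, ite_div, zero_div]
        split_ifs with hn
        · rw [prod_div_distrib, ← Nat.cast_prod, Nat.prod_primeFactors_of_squarefree hn]
        · rfl
    _ = ∑ s ∈ ((Ioc 0 N).filter Squarefree).image Nat.primeFactors, ∏ p ∈ s, f p / p :=
        (sum_image (f := fun s : Finset ℕ ↦ ∏ p ∈ s, f p / p) hinj).symm
    _ ≤ ∑ s ∈ ((Ioc 0 N).filter Nat.Prime).powerset, ∏ p ∈ s, f p / p := by
        refine sum_le_sum_of_subset_of_nonneg ?_ fun s hs _ ↦ prod_nonneg fun p hp ↦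
          div_nonneg (hf p (mem_filter.mp (mem_powerset.mp hs hp)).2) p.cast_nonneg
        intro s hs
        obtain ⟨n, hn, rfl⟩ := mem_image.mp hs
        simp only [mem_filter, mem_Ioc] at hn
        rw [mem_powerset]
        intro p hp
        simp only [mem_filter, mem_Ioc]
        exact ⟨⟨Nat.pos_of_mem_primeFactors hp, (Nat.le_of_mem_primeFactors hp).trans hn.1.2⟩,
          Nat.prime_of_mem_primeFactors hp⟩
    _ = ∏ p ∈ (Ioc 0 N).filter Nat.Prime, (1 + f p / p) := (prod_one_add _).symm
    _ ≤ ∏ p ∈ (Ioc 0 N).filter Nat.Prime, exp (f p / p) := by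
        refine prod_le_prod (fun p hp ↦ ?_) fun p _ ↦ ?_
        · have := div_nonneg (hf p (mem_filter.mp hp).2) p.cast_nonneg
          linarith
        · linarith [add_one_le_exp (f p / p)]
    _ = _ := (exp_sum _ _).symm

theorem exists_sum_prime_div_le {f : ℕ → ℝ} (hlog : ∀ p, p.Prime → f p * log p ≤ 1) :
    ∃ K : ℝ, ∀ N : ℕ, ∑ p ∈ (Ioc 0 N).filter Nat.Prime, f p / p ≤ K := by
  have l2 : 0 < log 2 := log_pos one_lt_two
  have hsum : Summable fun k : ℕ ↦ 4 / log 2 * (1 / (k : ℝ) ^ 2) :=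
    (summable_one_div_nat_pow.mpr one_lt_two).mul_left _
  refine ⟨∑' k : ℕ, 4 / log 2 * (1 / (k : ℝ) ^ 2), fun N ↦ ?_⟩
  have hmaps : ∀ p ∈ (Ioc 0 N).filter Nat.Prime, Nat.log 2 p ∈ range (N + 1) := by
    intro p hp
    simp only [mem_filter, mem_Ioc] at hp
    exact mem_range.mpr (Nat.lt_succ_of_le ((Nat.log_le_self 2 p).trans hp.1.2))
  rw [← sum_fiberwise_of_maps_to hmaps]
  refine (sum_le_sum fun k _ ↦ ?_).trans (hsum.sum_le_tsum _ fun k _ ↦ by positivity)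
  rcases Nat.eq_zero_or_pos k with rfl | hk
  · rw [sum_eq_zero]
    · simp
    · intro p hp
      simp only [mem_filter, Nat.log_eq_zero_iff] at hp
      have := hp.1.2.two_le
      omega
  have hk' : (0 : ℝ) < k := by exact_mod_cast hk
  have hden : (0 : ℝ) < 2 ^ k * (k * log 2) ^ 2 := by positivity
  calc _ ≤ ∑ p ∈ ((Ioc 0 N).filter Nat.Prime).filter fun p ↦ Nat.log 2 p = k,
          log p / (2 ^ k * (k * log 2) ^ 2) := by
        refine sum_le_sum fun p hp ↦ ?_
        simp only [mem_filter, mem_Ioc] at hp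
        obtain ⟨⟨-, hp⟩, rfl⟩ := hp
        have hpow : (2 : ℝ) ^ Nat.log 2 p ≤ p := by
          exact_mod_cast Nat.pow_log_le_self 2 hp.ne_zero
        have hkl : Nat.log 2 p * log 2 ≤ log p := by
          rw [← log_pow]
          exact log_le_log (by positivity) hpow
        have hp0 : (0 : ℝ) < p := by exact_mod_cast hp.pos
        have hl : 0 < log p := log_pos (by exact_mod_cast hp.one_lt)
        calc f p / p ≤ (1 / log p) / p := by
              gcongr
              exact (le_div_iff₀ hl).mpr (hlog p hp)
          _ = log p / (p * log p ^ 2) := by field_simp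
          _ ≤ _ := by gcongr
    _ ≤ Chebyshev.theta ((2 ^ (k + 1) : ℕ) : ℝ) / (2 ^ k * (k * log 2) ^ 2) := by
        rw [← sum_div]
        gcongr
        rw [Chebyshev.theta, Nat.floor_natCast]
        refine sum_le_sum_of_subset_of_nonneg ?_ fun p _ _ ↦ log_natCast_nonneg p
        intro p hp
        simp only [mem_filter, mem_Ioc] at hp ⊢
        obtain ⟨⟨⟨h0, -⟩, hp⟩, rfl⟩ := hp
        exact ⟨⟨h0, (Nat.lt_pow_succ_log_self one_lt_two p).le⟩, hp⟩
    _ ≤ (log 4 * (2 ^ (k + 1) : ℕ)) / (2 ^ k * (k * log 2) ^ 2) := by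
        gcongr
        exact Chebyshev.theta_le_log4_mul_x (Nat.cast_nonneg _)
    _ = 4 / log 2 * (1 / (k : ℝ) ^ 2) := by
        rw [show (4 : ℝ) = 2 ^ 2 by norm_num, log_pow]
        push_cast
        field_simp
        ring

theorem log_sq_le_mul_sqrt {x : ℝ} (hx : 1 ≤ x) : log x ^ 2 ≤ 16 * √x := by
  have h1 : log x = 4 * log √√x := by
    rw [log_sqrt (sqrt_nonneg _), log_sqrt (by linarith)]
    ring
  have h2 : log √√x ≤ √√x := log_le_self (sqrt_nonneg _)
  have h3 : 0 ≤ log x := log_nonneg hx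
  calc log x ^ 2 ≤ (4 * √√x) ^ 2 := by
        gcongr
        linarith
    _ = 16 * √x := by
        rw [mul_pow, sq_sqrt (sqrt_nonneg _)]
        norm_num

theorem exists_sum_squarefreeProd_le {f : ℕ → ℝ} (hf : ∀ p, p.Prime → 0 ≤ f p)
    (hf1 : ∀ p, p.Prime → f p ≤ 1) (hlog : ∀ p, p.Prime → f p * log p ≤ 1) :
    ∃ C : ℝ, 0 < C ∧ ∀ N : ℕ, 2 ≤ N →
      ∑ n ∈ Ioc 0 N, squarefreeProd f n ≤ C * (N / log N ^ 2) := by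
  obtain ⟨K, hK⟩ := exists_sum_prime_div_le hlog
  have l4 : 0 ≤ log 4 := log_nonneg (by norm_num)
  refine ⟨16 + 4 * ((log 4 + 2) * exp K), by positivity, fun N hN ↦ ?_⟩
  have hN2 : (2 : ℝ) ≤ N := by exact_mod_cast hN
  have hlN : 0 < log N := log_pos (by linarith)
  have H0 := squarefreeProd_nonneg hf
  have hpt : ∀ n ∈ Ioc 0 N, squarefreeProd f n ≤
      (if n ≤ Nat.sqrt N then 1 else 0) + 4 / log N ^ 2 * (squarefreeProd f n * log n ^ 2) := by
    intro n hn
    split_ifs with h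
    · have := squarefreeProd_le_one hf hf1 n
      have : 0 ≤ 4 / log N ^ 2 * (squarefreeProd f n * log n ^ 2) :=
        mul_nonneg (by positivity) (mul_nonneg (H0 n) (sq_nonneg _))
      linarith
    · have hsq : (N : ℝ) ≤ (n : ℝ) ^ 2 := by
        rw [not_le, Nat.sqrt_lt'] at h
        exact_mod_cast h.le
      have hl : log N ≤ 2 * log n := by
        have := log_le_log (by linarith) hsq
        rwa [log_pow] at this
      have hsq' : log N ^ 2 ≤ 4 * log n ^ 2 := by nlinarith
      rw [zero_add, div_mul_eq_mul_div, le_div_iff₀ (by positivity)]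
      nlinarith [mul_le_mul_of_nonneg_left hsq' (H0 n)]
  have hcount : ∑ n ∈ Ioc 0 N, (if n ≤ Nat.sqrt N then (1 : ℝ) else 0) ≤ 16 * (N / log N ^ 2) := by
    have h1 : ((Ioc 0 N).filter fun n ↦ n ≤ Nat.sqrt N) ⊆ Ioc 0 (Nat.sqrt N) := by
      intro n hn
      simp only [mem_filter, mem_Ioc] at hn ⊢
      exact ⟨hn.1.1, hn.2⟩
    have h2 := card_le_card h1
    rw [Nat.card_Ioc, Nat.sub_zero] at h2
    rw [sum_boole]
    calc _ ≤ ((Nat.sqrt N : ℕ) : ℝ) := by exact_mod_cast h2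
      _ ≤ √N := nat_sqrt_le_real_sqrt
      _ ≤ 16 * (N / log N ^ 2) := by
        rw [← mul_div_assoc, le_div_iff₀ (by positivity)]
        nlinarith [log_sq_le_mul_sqrt (x := N) (by linarith), sqrt_nonneg (N : ℝ),
          mul_self_sqrt (show (0 : ℝ) ≤ N by linarith)]
  have hmain : ∑ n ∈ Ioc 0 N, squarefreeProd f n * log n ^ 2 ≤ (log 4 + 2) * N * exp K := by
    refine (sum_squarefreeProd_mul_log_sq_le hf hlog N).trans ?_
    gcongr
    exact (sum_squarefreeProd_div_le hf N).trans (exp_le_exp.mpr (hK N))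
  calc _ ≤ _ := sum_le_sum hpt
    _ ≤ 16 * (N / log N ^ 2) + 4 / log N ^ 2 * ((log 4 + 2) * N * exp K) := by
        rw [sum_add_distrib, ← mul_sum]
        gcongr
    _ = _ := by ring

/-- The weight `1 / log p`, truncated to `p > e²`. -/
noncomputable def truncInvLog (p : ℕ) : ℝ := if (p : ℝ) ≤ exp 2 then 0 else (log p)⁻¹

theorem two_lt_log {x : ℝ} (hx : exp 2 < x) : 2 < log x :=
  (lt_log_iff_exp_lt ((exp_pos 2).trans hx)).mpr hx

theorem truncInvLog_nonneg (p : ℕ) : 0 ≤ truncInvLog p := by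
  rw [truncInvLog]
  split_ifs
  · rfl
  · exact inv_nonneg.mpr (log_natCast_nonneg p)

theorem truncInvLog_le_one (p : ℕ) : truncInvLog p ≤ 1 := by
  rw [truncInvLog]
  split_ifs with h
  · exact zero_le_one
  · exact inv_le_one_of_one_le₀ (by linarith [two_lt_log (not_le.mp h)])

theorem truncInvLog_mul_log_le_one (p : ℕ) : truncInvLog p * log p ≤ 1 := by
  rw [truncInvLog]
  split_ifs with h
  · simp
  · exact (inv_mul_cancel₀ (by linarith [two_lt_log (not_le.mp h)])).le

theorem weirdG_le (q : ℕ) : weirdG q ≤ q * squarefreeProd truncInvLog q := by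
  rw [weirdG, squarefreeProd_apply]
  split_ifs with hq
  · have hprod : (q : ℝ) = ∏ p ∈ q.primeFactors, (p : ℝ) := by
      rw [← Nat.cast_prod, Nat.prod_primeFactors_of_squarefree hq]
    rw [hprod, ← prod_mul_distrib]
    refine prod_le_prod (fun p _ ↦ ?_) fun p _ ↦ ?_
    · split_ifs
      · rfl
      · exact_mod_cast Int.floor_nonneg.mpr (div_nonneg p.cast_nonneg (log_natCast_nonneg p))
    · rw [truncInvLog]
      split_ifs
      · simp
      · exact Int.floor_le _
  · simp

theorem weirdG_prime {p : ℕ} (hp : p.Prime) :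
    weirdG p = if (p : ℝ) ≤ exp 2 then 0 else (⌊(p : ℝ) / log p⌋ : ℝ) := by
  simp [weirdG, hp.primeFactors, hp.prime.squarefree]

theorem weirdG_prime_nonneg {p : ℕ} (hp : p.Prime) : 0 ≤ weirdG p := by
  rw [weirdG_prime hp]
  split_ifs
  · rfl
  · exact_mod_cast Int.floor_nonneg.mpr (div_nonneg p.cast_nonneg (log_natCast_nonneg p))

theorem exp_two_lt_eight : exp 2 < 8 := by
  have h : exp 2 = exp 1 ^ 2 := by rw [← exp_nat_mul]; norm_num
  rw [h]
  nlinarith [exp_one_lt_d9, exp_pos 1]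

theorem le_weirdG_prime {p : ℕ} (hp : p.Prime) (h8 : 8 ≤ p) : p / (2 * log p) ≤ weirdG p := by
  have h8' : (8 : ℝ) ≤ p := by exact_mod_cast h8
  have hexp : exp 2 < p := exp_two_lt_eight.trans_le h8'
  have hl := two_lt_log hexp
  have hl2 : log p ≤ p / 2 := by
    have h1 := log_le_sub_one_of_pos (show (0 : ℝ) < p / 2 by linarith)
    rw [log_div (by linarith) two_ne_zero] at h1
    linarith [log_two_lt_d9]
  have h2 : 2 ≤ p / log p := by
    rw [le_div_iff₀ (by linarith)]
    linarith
  rw [weirdG_prime hp, if_neg hexp.not_ge, mul_comm, ← div_div]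
  linarith [Int.lt_floor_add_one ((p : ℝ) / log p)]

theorem eventually_le_theta_sub_theta :
    ∀ᶠ N : ℕ in Filter.atTop, (N : ℝ) / 10 ≤ Chebyshev.theta N - Chebyshev.theta (N / 4 : ℕ) := by
  have hlo := (isLittleO_log_rpow_atTop (show (0 : ℝ) < 1 / 2 by norm_num)).bound
    (show (0 : ℝ) < 1 / 20 by norm_num)
  filter_upwards [tendsto_natCast_atTop_atTop.eventually hlo, Filter.eventually_ge_atTop 20]
    with N hN hN20
  have hN20' : (20 : ℝ) ≤ N := by exact_mod_cast hN20
  rw [← sqrt_eq_rpow, norm_of_nonneg (log_natCast_nonneg N), norm_of_nonneg (sqrt_nonneg _)] at hN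
  have hsq := mul_self_sqrt (show (0 : ℝ) ≤ N by linarith)
  have hs1 : 1 ≤ √(N : ℝ) := one_le_sqrt.mpr (by linarith)
  have hlog1 : log (N + 1) ≤ log N + log 2 := by
    rw [← log_mul (by linarith) two_ne_zero]
    exact log_le_log (by linarith) (by linarith)
  have hquarter : Chebyshev.theta (N / 4 : ℕ) ≤ log 4 * (N / 4) := by
    refine (Chebyshev.theta_le_log4_mul_x (Nat.cast_nonneg _)).trans ?_
    have h0 : 0 ≤ log 4 := log_nonneg (by norm_num)
    gcongr
    exact_mod_cast Nat.cast_div_le (α := ℝ) (m := N) (n := 4)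
  have h4 : log 4 = 2 * log 2 := by
    rw [show (4 : ℝ) = 2 ^ 2 by norm_num, log_pow]
    norm_num
  rw [h4] at hquarter
  have h2 := log_two_gt_d9
  have h2' := log_two_lt_d9
  have := Chebyshev.theta_ge N
  have hprod : √(N : ℝ) * log N ≤ N / 20 := by nlinarith
  nlinarith

theorem eventually_le_sum_weirdG_prime :
    ∀ᶠ N : ℕ in Filter.atTop, 1 / 80 * ((N : ℝ) ^ 2 / log N ^ 2) ≤
      ∑ p ∈ (Icc 1 N).filter Nat.Prime, weirdG p := by
  filter_upwards [eventually_le_theta_sub_theta, Filter.eventually_ge_atTop 32] with N hN hN32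
  have hN0 : (32 : ℝ) ≤ N := by exact_mod_cast hN32
  have hlN : 0 < log N := log_pos (by linarith)
  have htheta : Chebyshev.theta N - Chebyshev.theta (N / 4 : ℕ)
      = ∑ p ∈ (Ioc (N / 4) N).filter Nat.Prime, log p := by
    rw [Chebyshev.theta, Chebyshev.theta, Nat.floor_natCast, Nat.floor_natCast, sum_filter,
      sum_filter, sum_filter, ← sum_Ioc_consecutive _ (Nat.zero_le _) (Nat.div_le_self N 4)]
    ring
  rw [htheta] at hN
  calc 1 / 80 * ((N : ℝ) ^ 2 / log N ^ 2) = N / (8 * log N ^ 2) * (N / 10) := by ring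
    _ ≤ N / (8 * log N ^ 2) * ∑ p ∈ (Ioc (N / 4) N).filter Nat.Prime, log p := by gcongr
    _ ≤ ∑ p ∈ (Ioc (N / 4) N).filter Nat.Prime, weirdG p := by
        rw [mul_sum]
        refine sum_le_sum fun p hp ↦ ?_
        simp only [mem_filter, mem_Ioc] at hp
        obtain ⟨⟨hlow, hup⟩, hp⟩ := hp
        refine le_trans ?_ (le_weirdG_prime hp (by omega))
        have hl : 0 < log p := log_pos (by exact_mod_cast hp.one_lt)
        have hlp : log p ≤ log N :=
          log_le_log (by exact_mod_cast hp.pos) (by exact_mod_cast hup)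
        have hN4 : (N : ℝ) ≤ 4 * p := by
          have : N ≤ 4 * p := by omega
          exact_mod_cast this
        calc N / (8 * log N ^ 2) * log p ≤ 4 * p / (8 * log p ^ 2) * log p := by gcongr
          _ = p / (2 * log p) := by
            field_simp
            ring
    _ ≤ _ := by
        refine sum_le_sum_of_subset_of_nonneg ?_ fun p hp _ ↦
          weirdG_prime_nonneg (mem_filter.mp hp).2
        refine filter_subset_filter _ fun p hp ↦ ?_
        simp only [mem_Ioc, mem_Icc] at hp ⊢
        omega

theorem sum_weirdG_le :
    ∃ C : ℝ, 0 < C ∧ ∃ x₀ : ℕ, ∀ x : ℕ, x₀ ≤ x →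
      ∑ q ∈ Finset.Icc 1 x, weirdG q ≤
        C * ∑ p ∈ (Finset.Icc 1 x).filter Nat.Prime, weirdG p := by
  obtain ⟨C, hC, hup⟩ := exists_sum_squarefreeProd_le (fun p _ ↦ truncInvLog_nonneg p)
    (fun p _ ↦ truncInvLog_le_one p) (fun p _ ↦ truncInvLog_mul_log_le_one p)
  obtain ⟨x₀, hlow⟩ := Filter.eventually_atTop.mp eventually_le_sum_weirdG_prime
  refine ⟨80 * C, by positivity, max x₀ 2, fun x hx ↦ ?_⟩
  calc ∑ q ∈ Icc 1 x, weirdG q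
      ≤ ∑ q ∈ Ioc 0 x, x * squarefreeProd truncInvLog q := by
        rw [← Icc_add_one_left_eq_Ioc, zero_add]
        refine sum_le_sum fun q hq ↦ (weirdG_le q).trans ?_
        gcongr
        · exact squarefreeProd_nonneg (fun p _ ↦ truncInvLog_nonneg p) q
        · exact (mem_Icc.mp hq).2
    _ ≤ x * (C * (x / log x ^ 2)) := by
        rw [← mul_sum]
        gcongr
        exact hup x ((le_max_right _ _).trans hx)
    _ = 80 * C * (1 / 80 * ((x : ℝ) ^ 2 / log x ^ 2)) := by ring
    _ ≤ _ := by
        gcongr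
        exact hlow x ((le_max_left _ _).trans hx)
end

section
/- Let 𝒬 be a set of primes and let x be large with log x ≤ z ≤ x. Then the number of integers q ≤ x supported on primes in 𝒬 all of which are ≤ z satisfies: #{q ≤ x : p | q ⟹ (p ∈ 𝒬 and p ≤ z)} ≪ (x/log x) exp(−(log x)/(log z)) ∏_{p ≤ z, p ∈ 𝒬} (1 + 1/p), with an absolute implied constant. -/
open Finset
open scoped Classical

namespace SmoothBound

open Nat ArithmeticFunction

theorem log_four_le_two : Real.log 4 ≤ 2 := by
  have := Real.log_two_lt_d9
  rw [show (4 : ℝ) = 2 ^ 2 by norm_num, Real.log_pow]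
  push_cast
  linarith

theorem sum_log_div_primesLE_le (N : ℕ) :
    ∑ p ∈ primesLE N, Real.log p / p ≤ Real.log N + Real.log 4 := by
  rcases N.eq_zero_or_pos with rfl | hN
  · have : (0 : ℝ) ≤ Real.log 4 := Real.log_nonneg (by norm_num)
    simpa [primesLE_eq_filter_Icc_one] using this
  have hN' : (0 : ℝ) < N := by exact_mod_cast hN
  have hΛ : ∑ n ∈ Ioc 0 N, vonMangoldt n * ((N / n : ℕ) : ℝ) ≤ N * Real.log N := by
    rw [← sum_Ioc_mul_zeta_eq_sum, vonMangoldt_mul_zeta]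
    calc ∑ n ∈ Ioc 0 N, ArithmeticFunction.log n ≤ ∑ n ∈ Ioc 0 N, Real.log N := by
          refine sum_le_sum fun n hn ↦ ?_
          rw [mem_Ioc] at hn
          rw [log_apply]
          exact Real.log_le_log (by exact_mod_cast hn.1) (by exact_mod_cast hn.2)
      _ = N * Real.log N := by simp
  have hprime : ∑ p ∈ primesLE N, Real.log p * ((N / p : ℕ) : ℝ) ≤
      ∑ n ∈ Ioc 0 N, vonMangoldt n * ((N / n : ℕ) : ℝ) := by
    rw [primesLE_eq_filter_Ioc_zero]
    calc ∑ p ∈ Ioc 0 N with p.Prime, Real.log p * ((N / p : ℕ) : ℝ)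
        = ∑ p ∈ Ioc 0 N with p.Prime, vonMangoldt p * ((N / p : ℕ) : ℝ) := by
          refine sum_congr rfl fun p hp ↦ ?_
          rw [vonMangoldt_apply_prime (mem_filter.mp hp).2]
      _ ≤ _ := sum_le_sum_of_subset_of_nonneg (filter_subset _ _) fun _ _ _ ↦
          mul_nonneg vonMangoldt_nonneg (Nat.cast_nonneg _)
  have hθ : ∑ p ∈ primesLE N, Real.log p ≤ Real.log 4 * N := by
    rw [← Chebyshev.theta_eq_sum_primesLE_log]
    exact Chebyshev.theta_le_log4_mul_x hN'.le
  have hsum : ∑ p ∈ primesLE N, Real.log p / p * N ≤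
      ∑ p ∈ primesLE N, (Real.log p * ((N / p : ℕ) : ℝ) + Real.log p) := by
    refine sum_le_sum fun p hp ↦ ?_
    have h1 : (N : ℝ) / p ≤ ((N / p : ℕ) : ℝ) + 1 := by
      rw [← Nat.floor_div_eq_div (K := ℝ)]
      exact (Nat.lt_floor_add_one _).le
    calc Real.log p / p * N = Real.log p * (N / p) := by ring
      _ ≤ Real.log p * (((N / p : ℕ) : ℝ) + 1) :=
          mul_le_mul_of_nonneg_left h1 (Real.log_natCast_nonneg p)
      _ = _ := by ring
  rw [← sum_mul, sum_add_distrib] at hsum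
  refine le_of_mul_le_mul_right ?_ hN'
  linarith

theorem sum_log_factoredNumbers_le (s : Finset ℕ) (N : ℕ) :
    ∑ q ∈ Ioc 0 N with q ∈ factoredNumbers s, Real.log q ≤
      ∑ m ∈ Ioc 0 N with m ∈ factoredNumbers s,
        ∑ n ∈ Ioc 0 (N / m) with n ∈ factoredNumbers s, vonMangoldt n := by
  let g : ArithmeticFunction ℝ :=
    ⟨fun n ↦ if n ∈ factoredNumbers s then 1 else 0, by simp [mem_factoredNumbers]⟩
  let f : ArithmeticFunction ℝ :=
    ⟨fun n ↦ if n ∈ factoredNumbers s then vonMangoldt n else 0, by simp⟩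
  have hg (n : ℕ) : g n = if n ∈ factoredNumbers s then 1 else 0 := rfl
  have hf (n : ℕ) : f n = if n ∈ factoredNumbers s then vonMangoldt n else 0 := rfl
  have key (q : ℕ) (hq : q ∈ factoredNumbers s) : Real.log q = (g * f) q := by
    rw [← log_apply, ← zeta_mul_vonMangoldt, mul_apply, mul_apply]
    refine sum_congr rfl fun x hx ↦ ?_
    have hx' := Nat.mem_divisorsAntidiagonal.mp hx
    rw [hg, hf, if_pos (mem_factoredNumbers_of_dvd hq ⟨_, hx'.1.symm⟩),
      if_pos (mem_factoredNumbers_of_dvd hq ⟨_, by rw [mul_comm]; exact hx'.1.symm⟩)]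
    have : x.1 ≠ 0 := by
      intro h
      apply hx'.2
      rw [← hx'.1, h, zero_mul]
    simp [this]
  have hpos (q : ℕ) : 0 ≤ (g * f) q := by
    rw [mul_apply]
    refine sum_nonneg fun x _ ↦ ?_
    rw [hg, hf]
    split_ifs <;> simp
  calc ∑ q ∈ Ioc 0 N with q ∈ factoredNumbers s, Real.log q
      = ∑ q ∈ Ioc 0 N with q ∈ factoredNumbers s, (g * f) q :=
        sum_congr rfl fun q hq ↦ key q (mem_filter.mp hq).2
    _ ≤ ∑ q ∈ Ioc 0 N, (g * f) q :=
        sum_le_sum_of_subset_of_nonneg (filter_subset _ _) fun _ _ _ ↦ hpos _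
    _ = _ := by
        rw [sum_Ioc_mul_eq_sum_sum, sum_filter]
        refine sum_congr rfl fun m _ ↦ ?_
        rw [hg, sum_filter]
        simp only [hf]
        split_ifs <;> simp

theorem sum_vonMangoldt_factoredNumbers_le_card_mul_log (s : Finset ℕ) {y : ℝ} (hy : 1 ≤ y) :
    ∑ n ∈ Ioc 0 ⌊y⌋₊ with n ∈ factoredNumbers s, vonMangoldt n ≤ #s * Real.log y := by
  set N := ⌊y⌋₊ with hN
  have hN1 : 1 ≤ N := Nat.le_floor (by simpa using hy)
  have hNy : (N : ℝ) ≤ y := Nat.floor_le (by linarith)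
  set B := {n ∈ Ioc 0 N | n ∈ factoredNumbers s ∧ IsPrimePow n} with hB
  have h1 : ∑ n ∈ Ioc 0 N with n ∈ factoredNumbers s, vonMangoldt n = ∑ n ∈ B, vonMangoldt n := by
    rw [hB, ← filter_filter, sum_filter (p := fun n ↦ IsPrimePow n)]
    refine sum_congr rfl fun n _ ↦ ?_
    split_ifs with h
    · rfl
    · exact vonMangoldt_eq_zero_iff.mpr h
  have hmaps : ∀ n ∈ B, n.minFac ∈ s := by
    intro n hn
    have hn' := (mem_filter.mp hn).2
    exact mem_factoredNumbers'.mp hn'.1 _ (minFac_prime hn'.2.ne_one) (minFac_dvd n)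
  rw [h1, ← sum_fiberwise_of_maps_to hmaps, ← nsmul_eq_mul, ← sum_const]
  refine sum_le_sum fun p hp ↦ ?_
  by_cases hpp : p.Prime
  · have hsub : {n ∈ B | n.minFac = p} ⊆ image (p ^ ·) (Icc 1 (Nat.log p N)) := by
      intro n hn
      simp only [hB, mem_filter, mem_Ioc] at hn
      obtain ⟨⟨⟨hn0, hnN⟩, -, hpow⟩, rfl⟩ := hn
      obtain ⟨k, hkn⟩ : ∃ k, n.minFac ^ k = n :=
        ⟨_, (isPrimePow_iff_minFac_pow_factorization_eq hpow.ne_one).mp hpow⟩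
      refine mem_image.mpr ⟨k, mem_Icc.mpr ⟨?_, ?_⟩, hkn⟩
      · rcases Nat.eq_zero_or_pos k with h0 | h0
        · rw [h0, pow_zero] at hkn
          exact absurd hkn.symm hpow.ne_one
        · exact h0
      · exact Nat.le_log_of_pow_le hpp.one_lt (hkn.trans_le hnN)
    have hlog : (Nat.log p N : ℝ) * Real.log p ≤ Real.log y := by
      rw [← Real.log_pow]
      refine Real.log_le_log (by have := hpp.pos; positivity) (le_trans ?_ hNy)
      exact_mod_cast Nat.pow_log_le_self p (by lia)
    calc ∑ n ∈ B with n.minFac = p, vonMangoldt n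
        = ∑ n ∈ B with n.minFac = p, Real.log p := by
          refine sum_congr rfl fun n hn ↦ ?_
          simp only [hB, mem_filter] at hn
          rw [vonMangoldt_apply, if_pos hn.1.2.2, hn.2]
      _ = #{n ∈ B | n.minFac = p} * Real.log p := by simp
      _ ≤ Nat.log p N * Real.log p := by
          refine mul_le_mul_of_nonneg_right ?_ (Real.log_natCast_nonneg p)
          have := (card_le_card hsub).trans card_image_le
          rw [Nat.card_Icc, Nat.add_sub_cancel] at this
          exact_mod_cast this
      _ ≤ _ := hlog
  · have : {n ∈ B | n.minFac = p} = ∅ := by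
      refine filter_eq_empty_iff.mpr fun n hn h ↦ hpp ?_
      rw [← h]
      exact minFac_prime (mem_filter.mp hn).2.2.ne_one
    rw [this, sum_empty]
    exact Real.log_nonneg hy

theorem primeCounting_le_six_mul_div_log {z : ℝ} (hz : 4 ≤ Real.log z) (hz0 : 0 < z) :
    (primeCounting ⌊z⌋₊ : ℝ) ≤ 6 * z / Real.log z := by
  have hz1 : 1 < z := (Real.log_pos_iff hz0.le).mp (by linarith)
  have h4 := log_four_le_two
  have hs : 0 < √z := Real.sqrt_pos.mpr hz0
  have hlogs : Real.log √z = Real.log z / 2 := Real.log_sqrt hz0.le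
  have hle : Real.log z ≤ 2 * √z := by
    have := Real.log_le_self hs.le
    linarith
  have hL : 0 < Real.log z := by linarith
  refine (Chebyshev.pi_le_log4_mul_div hz1).trans ?_
  rw [hlogs, le_div_iff₀ hL]
  have h1 : Real.log 4 * z / (Real.log z / 2) * Real.log z = 2 * Real.log 4 * z := by
    field_simp
  have h2 : √z * Real.log z ≤ 2 * z := by
    nlinarith [Real.mul_self_sqrt hz0.le]
  nlinarith

theorem sum_vonMangoldt_factoredNumbers_le {s : Finset ℕ} {z y : ℝ} (hz0 : 0 < z)
    (hz : 4 ≤ Real.log z) (hs : s ⊆ primesLE ⌊z⌋₊) (hy : 1 ≤ y) :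
    ∑ n ∈ Ioc 0 ⌊y⌋₊ with n ∈ factoredNumbers s, vonMangoldt n ≤
      18 * y ^ (1 - 1 / Real.log z) := by
  have hL : 0 < Real.log z := by linarith
  have hy0 : 0 < y := by linarith
  have he : Real.exp 1 ≤ 3 := by linarith [Real.exp_one_lt_d9]
  have hly : 0 ≤ Real.log y := Real.log_nonneg hy
  rcases le_total y z with hyz | hzy
  · have h4 := log_four_le_two
    have h1 : y ≤ 3 * y ^ (1 - 1 / Real.log z) := by
      calc y = Real.exp (Real.log y) := (Real.exp_log hy0).symm
        _ ≤ Real.exp (1 + Real.log y * (1 - 1 / Real.log z)) := by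
            refine Real.exp_le_exp.mpr ?_
            have : Real.log y / Real.log z ≤ 1 :=
              (div_le_one hL).mpr (Real.log_le_log hy0 hyz)
            have h : Real.log y * (1 - 1 / Real.log z) =
              Real.log y - Real.log y / Real.log z := by ring
            linarith
        _ = Real.exp 1 * y ^ (1 - 1 / Real.log z) := by
            rw [Real.exp_add, Real.rpow_def_of_pos hy0]
        _ ≤ _ := by gcongr
    calc ∑ n ∈ Ioc 0 ⌊y⌋₊ with n ∈ factoredNumbers s, vonMangoldt n
        ≤ Chebyshev.psi y :=
          sum_le_sum_of_subset_of_nonneg (filter_subset _ _) fun _ _ _ ↦ vonMangoldt_nonneg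
      _ ≤ (Real.log 4 + 4) * y := Chebyshev.psi_le_const_mul_self hy0.le
      _ ≤ 6 * y := by gcongr; linarith
      _ ≤ _ := by linarith
  · have hcard : (#s : ℝ) ≤ 6 * z / Real.log z := by
      refine le_trans ?_ (primeCounting_le_six_mul_div_log hz hz0)
      rw [← primesLE_card_eq_primeCounting]
      exact_mod_cast card_le_card hs
    set v := Real.log y / Real.log z with hv
    have hv1 : 1 ≤ v := (one_le_div hL).mpr (Real.log_le_log hz0 hzy)
    have hvy : Real.log y = v * Real.log z := by rw [hv]; field_simp
    have hmain : z * v ≤ 3 * y ^ (1 - 1 / Real.log z) := by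
      calc z * v ≤ Real.exp (Real.log z) * Real.exp (v - 1) := by
            rw [Real.exp_log hz0]
            refine mul_le_mul_of_nonneg_left ?_ hz0.le
            linarith [Real.add_one_le_exp (v - 1)]
        _ ≤ Real.exp (1 + Real.log y * (1 - 1 / Real.log z)) := by
            rw [← Real.exp_add]
            refine Real.exp_le_exp.mpr ?_
            have h : Real.log y * (1 - 1 / Real.log z) = v * Real.log z - v := by
              rw [hvy]; field_simp
            rw [h]
            nlinarith
        _ = Real.exp 1 * y ^ (1 - 1 / Real.log z) := by
            rw [Real.exp_add, Real.rpow_def_of_pos hy0]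
        _ ≤ _ := by gcongr
    calc ∑ n ∈ Ioc 0 ⌊y⌋₊ with n ∈ factoredNumbers s, vonMangoldt n
        ≤ #s * Real.log y := sum_vonMangoldt_factoredNumbers_le_card_mul_log s hy
      _ ≤ 6 * z / Real.log z * Real.log y := by gcongr
      _ = 6 * (z * v) := by rw [hv]; ring
      _ ≤ _ := by linarith

theorem sum_rpow_neg_factoredNumbers_le {s : Finset ℕ} (hs : ∀ p ∈ s, p.Prime) {σ : ℝ}
    (hσ : 0 < σ) (N : ℕ) :
    ∑ m ∈ Ioc 0 N with m ∈ factoredNumbers s, (m : ℝ) ^ (-σ) ≤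
      ∏ p ∈ s, (1 - (p : ℝ) ^ (-σ))⁻¹ := by
  let f : ℕ →* ℝ :=
    { toFun := fun n ↦ (n : ℝ) ^ (-σ)
      map_one' := by simp
      map_mul' := fun a b ↦ by
        push_cast
        exact Real.mul_rpow (Nat.cast_nonneg a) (Nat.cast_nonneg b) }
  have hf (n : ℕ) : f n = (n : ℝ) ^ (-σ) := rfl
  have hf0 (n : ℕ) : 0 ≤ f n := Real.rpow_nonneg (Nat.cast_nonneg n) _
  have hlt {p : ℕ} (hp : p.Prime) : ‖f p‖ < 1 := by
    rw [Real.norm_of_nonneg (hf0 p), hf]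
    exact Real.rpow_lt_one_of_one_lt_of_neg (by exact_mod_cast hp.one_lt) (by linarith)
  have hsum := (EulerProduct.summable_and_hasSum_factoredNumbers_prod_filter_prime_geometric
    hlt s).2
  rw [filter_true_of_mem hs] at hsum
  have := sum_le_hasSum ((Ioc 0 N).subtype (· ∈ factoredNumbers s)) (fun m _ ↦ hf0 m) hsum
  rwa [sum_subtype_eq_sum_filter (f := fun m ↦ f m)] at this

theorem inv_one_sub_rpow_le {z : ℝ} (hz : 4 ≤ Real.log z) {p : ℕ} (hp : p.Prime)
    (hpz : (p : ℝ) ≤ z) :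
    (1 - (p : ℝ) ^ (-(1 - 1 / Real.log z)))⁻¹ ≤
      (1 + 1 / (p : ℝ)) *
        Real.exp (2 / Real.log z * (Real.log p / p) + 3 * (1 / (p : ℝ) ^ (3 / 2 : ℝ))) := by
  have hL : 0 < Real.log z := by linarith
  have hp2 : (2 : ℝ) ≤ p := by exact_mod_cast hp.two_le
  have hp0 : (0 : ℝ) < p := by linarith
  have hlp : 0 ≤ Real.log p := Real.log_natCast_nonneg p
  set w := (p : ℝ) ^ (-(1 - 1 / Real.log z)) with hw
  have hτ : 1 / Real.log z ≤ 1 / 4 := one_div_le_one_div_of_le (by norm_num) hz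
  have hw0 : 0 < w := Real.rpow_pos_of_pos hp0 _
  have hw34 : w ≤ (p : ℝ) ^ (-(3 / 4) : ℝ) :=
    Real.rpow_le_rpow_of_exponent_le (by linarith) (by linarith)
  have hwsq : w ^ 2 ≤ 1 / (p : ℝ) ^ (3 / 2 : ℝ) := by
    calc w ^ 2 ≤ ((p : ℝ) ^ (-(3 / 4) : ℝ)) ^ 2 := by gcongr
      _ = (p : ℝ) ^ (-(3 / 2) : ℝ) := by
          rw [← Real.rpow_natCast, ← Real.rpow_mul hp0.le]; norm_num
      _ = _ := by rw [Real.rpow_neg hp0.le, one_div]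
  have hw23 : w ≤ 2 / 3 := by
    have h4 : w ^ 4 ≤ (2 / 3 : ℝ) ^ 4 := by
      calc w ^ 4 ≤ ((p : ℝ) ^ (-(3 / 4) : ℝ)) ^ 4 := by gcongr
        _ = ((p : ℝ) ^ 3)⁻¹ := by
            rw [← Real.rpow_natCast, ← Real.rpow_mul hp0.le]
            norm_num
        _ ≤ ((2 : ℝ) ^ 3)⁻¹ := by gcongr
        _ ≤ _ := by norm_num
    exact le_of_pow_le_pow_left₀ (by norm_num) (by norm_num) h4
  have hwp : w ≤ 1 / p + 2 / Real.log z * (Real.log p / p) := by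
    set t := Real.log p / Real.log z with ht
    have ht0 : 0 ≤ t := by positivity
    have ht1 : t ≤ 1 := (div_le_one hL).mpr (Real.log_le_log hp0 hpz)
    have hexp : Real.exp t ≤ 1 + 2 * t := by
      have := Real.abs_exp_sub_one_sub_id_le (x := t) (by rw [abs_of_nonneg ht0]; exact ht1)
      have := (abs_le.mp this).2
      nlinarith
    have hweq : w = Real.exp t / p := by
      rw [hw, Real.rpow_def_of_pos hp0, ht]
      nth_rewrite 3 [← Real.exp_log hp0]
      rw [← Real.exp_sub]
      congr 1
      ring
    calc w = Real.exp t / p := hweq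
      _ ≤ (1 + 2 * t) / p := by gcongr
      _ = _ := by rw [ht]; ring
  have hinv : (1 - w)⁻¹ ≤ 1 + w + 3 * w ^ 2 := by
    rw [inv_le_iff_one_le_mul₀ (by linarith)]
    nlinarith [sq_nonneg w]
  set a := 2 / Real.log z * (Real.log p / p) + 3 * (1 / (p : ℝ) ^ (3 / 2 : ℝ)) with ha
  have ha0 : 0 ≤ a := by positivity
  have hip : 0 < 1 / (p : ℝ) := by positivity
  calc (1 - w)⁻¹ ≤ 1 + w + 3 * w ^ 2 := hinv
    _ ≤ (1 + 1 / (p : ℝ)) * (1 + a) := by nlinarith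
    _ ≤ _ := by
      gcongr
      linarith [Real.add_one_le_exp a]

theorem exists_prod_inv_one_sub_rpow_le :
    ∃ K : ℝ, 0 < K ∧ ∀ (z : ℝ) (s : Finset ℕ), 0 < z → 4 ≤ Real.log z → s ⊆ primesLE ⌊z⌋₊ →
      ∏ p ∈ s, (1 - (p : ℝ) ^ (-(1 - 1 / Real.log z)))⁻¹ ≤ K * ∏ p ∈ s, (1 + 1 / (p : ℝ)) := by
  have hsummable : Summable fun n : ℕ ↦ 1 / (n : ℝ) ^ (3 / 2 : ℝ) :=
    Real.summable_one_div_nat_rpow.mpr (by norm_num)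
  refine ⟨Real.exp (4 + 3 * ∑' n : ℕ, 1 / (n : ℝ) ^ (3 / 2 : ℝ)), Real.exp_pos _, ?_⟩
  intro z s hz0 hz hs
  have hL : 0 < Real.log z := by linarith
  have hmem (p : ℕ) (hp : p ∈ s) : p.Prime ∧ (p : ℝ) ≤ z := by
    have := mem_primesLE.mp (hs hp)
    exact ⟨this.2, (Nat.le_floor_iff hz0.le).mp this.1⟩
  have h4 := log_four_le_two
  have hlogsum : ∑ p ∈ s, Real.log p / p ≤ 2 * Real.log z := by
    calc ∑ p ∈ s, Real.log p / p ≤ ∑ p ∈ primesLE ⌊z⌋₊, Real.log p / p :=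
          sum_le_sum_of_subset_of_nonneg hs fun p _ _ ↦
            div_nonneg (Real.log_natCast_nonneg p) (Nat.cast_nonneg p)
      _ ≤ Real.log ⌊z⌋₊ + Real.log 4 := sum_log_div_primesLE_le _
      _ ≤ Real.log z + 2 := by
          have hz1 : 1 ≤ z := ((Real.log_pos_iff hz0.le).mp hL).le
          gcongr
          · exact_mod_cast Nat.floor_pos.mpr hz1
          · exact Nat.floor_le hz0.le
      _ ≤ _ := by linarith
  calc ∏ p ∈ s, (1 - (p : ℝ) ^ (-(1 - 1 / Real.log z)))⁻¹
      ≤ ∏ p ∈ s, ((1 + 1 / (p : ℝ)) *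
        Real.exp (2 / Real.log z * (Real.log p / p) + 3 * (1 / (p : ℝ) ^ (3 / 2 : ℝ)))) := by
        refine prod_le_prod (fun p hp ↦ ?_) fun p hp ↦
          inv_one_sub_rpow_le hz (hmem p hp).1 (hmem p hp).2
        have hτ : 1 / Real.log z ≤ 1 / 4 := one_div_le_one_div_of_le (by norm_num) hz
        have := Real.rpow_le_one_of_one_le_of_nonpos (x := p) (z := -(1 - 1 / Real.log z))
          (by exact_mod_cast (hmem p hp).1.one_le) (by linarith)
        exact inv_nonneg.mpr (by linarith)
    _ = Real.exp (2 / Real.log z * ∑ p ∈ s, Real.log p / p +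
          3 * ∑ p ∈ s, 1 / (p : ℝ) ^ (3 / 2 : ℝ)) * ∏ p ∈ s, (1 + 1 / (p : ℝ)) := by
        rw [prod_mul_distrib, ← Real.exp_sum, sum_add_distrib, mul_sum, mul_sum, mul_comm]
    _ ≤ _ := by
        refine mul_le_mul_of_nonneg_right (Real.exp_le_exp.mpr ?_)
          (prod_nonneg fun p _ ↦ by positivity)
        have h1 : 2 / Real.log z * ∑ p ∈ s, Real.log p / p ≤ 4 := by
          calc 2 / Real.log z * ∑ p ∈ s, Real.log p / p ≤ 2 / Real.log z * (2 * Real.log z) := by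
                gcongr
            _ = 4 := by field_simp; norm_num
        have h2 := hsummable.sum_le_tsum s fun n _ ↦ by positivity
        linarith

theorem card_factoredNumbers_mul_log_le {s : Finset ℕ} {z x : ℝ} (hz0 : 0 < z)
    (hz : 4 ≤ Real.log z) (hs : s ⊆ primesLE ⌊z⌋₊) (hx : 1 ≤ x) :
    (#{q ∈ Ioc 0 ⌊x⌋₊ | q ∈ factoredNumbers s} : ℝ) * Real.log x ≤
      20 * (x * Real.exp (-(Real.log x / Real.log z))) *
        ∏ p ∈ s, (1 - (p : ℝ) ^ (-(1 - 1 / Real.log z)))⁻¹ := by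
  have hx0 : 0 < x := by linarith
  set σ := 1 - 1 / Real.log z with hσ
  have hτ : 1 / Real.log z ≤ 1 / 4 := one_div_le_one_div_of_le (by norm_num) hz
  have hσ1 : 3 / 4 ≤ σ := by linarith
  set A := {q ∈ Ioc 0 ⌊x⌋₊ | q ∈ factoredNumbers s} with hA
  have hmem (q : ℕ) (hq : q ∈ A) : (0 : ℝ) < q ∧ 1 ≤ x / q := by
    have h := mem_Ioc.mp (mem_filter.mp hq).1
    have h0 : (0 : ℝ) < q := by exact_mod_cast h.1
    exact ⟨h0, (one_le_div h0).mpr ((Nat.le_floor_iff hx0.le).mp h.2)⟩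
  have hsplit : (#A : ℝ) * Real.log x = ∑ q ∈ A, Real.log (x / q) + ∑ q ∈ A, Real.log q := by
    rw [← sum_add_distrib, ← nsmul_eq_mul, ← sum_const]
    refine sum_congr rfl fun q hq ↦ ?_
    rw [Real.log_div hx0.ne' (hmem q hq).1.ne', sub_add_cancel]
  have hfirst : ∑ q ∈ A, Real.log (x / q) ≤ ∑ q ∈ A, 2 * (x / q) ^ σ := by
    refine sum_le_sum fun q hq ↦ ?_
    have hxq : 0 ≤ x / q := by linarith [(hmem q hq).2]
    refine (Real.log_le_rpow_div hxq (by linarith : 0 < σ)).trans ?_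
    rw [div_le_iff₀ (by linarith)]
    nlinarith [Real.rpow_nonneg hxq σ]
  have hsecond : ∑ q ∈ A, Real.log q ≤ ∑ q ∈ A, 18 * (x / q) ^ σ := by
    refine (sum_log_factoredNumbers_le s ⌊x⌋₊).trans (sum_le_sum fun m hm ↦ ?_)
    rw [← Nat.floor_div_natCast]
    exact sum_vonMangoldt_factoredNumbers_le hz0 hz hs (hmem m hm).2
  have hxσ : x ^ σ = x * Real.exp (-(Real.log x / Real.log z)) := by
    nth_rewrite 2 [← Real.exp_log hx0]
    rw [← Real.exp_add, Real.rpow_def_of_pos hx0, hσ]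
    congr 1
    ring
  calc (#A : ℝ) * Real.log x ≤ ∑ q ∈ A, 2 * (x / q) ^ σ + ∑ q ∈ A, 18 * (x / q) ^ σ := by
        linarith
    _ = 20 * x ^ σ * ∑ q ∈ A, (q : ℝ) ^ (-σ) := by
        rw [← sum_add_distrib, mul_sum]
        refine sum_congr rfl fun q hq ↦ ?_
        rw [Real.div_rpow hx0.le (Nat.cast_nonneg q), Real.rpow_neg (Nat.cast_nonneg q)]
        ring
    _ ≤ 20 * x ^ σ * ∏ p ∈ s, (1 - (p : ℝ) ^ (-σ))⁻¹ := by
        refine mul_le_mul_of_nonneg_left ?_ (by positivity)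
        exact sum_rpow_neg_factoredNumbers_le (fun p hp ↦ (mem_primesLE.mp (hs hp)).2)
          (by linarith) _
    _ = _ := by rw [hxσ]

end SmoothBound

theorem card_smooth_Q_upper_bound :
    ∃ C : ℝ, 0 < C ∧ ∃ x₀ : ℝ, ∀ (Q : Set ℕ), (∀ p ∈ Q, Nat.Prime p) →
      ∀ x z : ℝ, x₀ ≤ x → Real.log x ≤ z → z ≤ x →
        (((Finset.Icc 1 ⌊x⌋₊).filter
            (fun q => ∀ p : ℕ, p.Prime → p ∣ q → p ∈ Q ∧ (p : ℝ) ≤ z)).card : ℝ) ≤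
          C * (x / Real.log x) * Real.exp (-(Real.log x / Real.log z)) *
            ∏ p ∈ (Finset.Icc 1 ⌊z⌋₊).filter (fun p => p.Prime ∧ p ∈ Q),
              (1 + 1 / (p : ℝ)) := by
  obtain ⟨K, hK, hprod⟩ := SmoothBound.exists_prod_inv_one_sub_rpow_le
  refine ⟨20 * K, by positivity, Real.exp (Real.exp 4), ?_⟩
  intro Q hQ x z hx hxz hzx
  have hx0 : 0 < x := (Real.exp_pos _).trans_le hx
  have hlogx : Real.exp 4 ≤ Real.log x := (Real.le_log_iff_exp_le hx0).mpr hx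
  have hlogx0 : 0 < Real.log x := (Real.exp_pos _).trans_le hlogx
  have hz0 : 0 < z := hlogx0.trans_le hxz
  have hz : 4 ≤ Real.log z := (Real.le_log_iff_exp_le hz0).mpr (hlogx.trans hxz)
  have hx1 : 1 ≤ x := ((Real.log_pos_iff hx0.le).mp hlogx0).le
  set s := (Finset.Icc 1 ⌊z⌋₊).filter (fun p => p.Prime ∧ p ∈ Q) with hsdef
  have hs : s ⊆ Nat.primesLE ⌊z⌋₊ := by
    intro p hp
    simp only [hsdef, mem_filter, mem_Icc] at hp
    exact Nat.mem_primesLE.mpr ⟨hp.1.2, hp.2.1⟩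
  have hset : (Finset.Icc 1 ⌊x⌋₊).filter
      (fun q => ∀ p : ℕ, p.Prime → p ∣ q → p ∈ Q ∧ (p : ℝ) ≤ z) =
      {q ∈ Ioc 0 ⌊x⌋₊ | q ∈ Nat.factoredNumbers s} := by
    ext q
    simp only [mem_filter, mem_Icc, mem_Ioc, Nat.succ_le_iff, Nat.mem_factoredNumbers', hsdef,
      Nat.le_floor_iff hz0.le, and_congr_right_iff]
    refine fun _ ↦ forall₃_congr fun p hp _ ↦ ?_
    simp only [hp, hp.pos, true_and, and_comm]
  rw [hset]
  have hmain := (SmoothBound.card_factoredNumbers_mul_log_le hz0 hz hs hx1).trans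
    (mul_le_mul_of_nonneg_left (hprod z s hz0 hz hs) (by positivity))
  rw [← le_div_iff₀ hlogx0] at hmain
  refine hmain.trans_eq ?_
  ring
end
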